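/- Let t ≥ 1 and let X_1, ..., X_t be finite nonempty subsets of P^1. Let Z = X_1 x X_2 x ... x X_t ⊆ P^1 x ... x P^1 (t factors) and let I = I(Z) be its defining multihomogeneous ideal. Then I^m = I^(m) for all m ≥ 1, where I^(m) = ∩_{P in Z} I(P)^m. -/

import Mathlib

open MvPolynomial

noncomputable section

/-- Two (nonzero) vectors of `k²` define the same point of `P^1`. -/
def ProjEq {k : Type*} [Field k] (u v : k × k) : Prop := u.1 * v.2 = u.2 * v.1

/-- The multihomogeneous ideal of the point `P = ([a_{1,0}:a_{1,1}], ..., [a_{t,0}:a_{t,1}])`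
of `(P^1)^t`, generated by the `t` linear forms `a_{i,1}*x_{i,0} - a_{i,0}*x_{i,1}`. -/
def pointIdealMulti {k : Type*} [Field k] {t : ℕ} (P : Fin t → k × k) :
    Ideal (MvPolynomial (Fin t × Fin 2) k) :=
  Ideal.span (Set.range fun i : Fin t => C (P i).2 * X (i, 0) - C (P i).1 * X (i, 1))

/-- Coefficientwise extension of a linear map. -/
def coeffMap {k A : Type*} [Field k] [CommRing A] [Algebra k A] (π : A →ₗ[k] A)
    (p : MvPolynomial (Fin 2) A) : MvPolynomial (Fin 2) A :=
  ∑ s ∈ p.support, monomial s (π (coeff s p))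

theorem coeff_coeffMap {k A : Type*} [Field k] [CommRing A] [Algebra k A] (π : A →ₗ[k] A)
    (p : MvPolynomial (Fin 2) A) (s : Fin 2 →₀ ℕ) :
    coeff s (coeffMap π p) = π (coeff s p) := by
  classical
  unfold coeffMap
  rw [coeff_sum]
  simp only [coeff_monomial]
  rw [Finset.sum_ite_eq']
  split_ifs with h
  · rfl
  · rw [notMem_support_iff.mp h, map_zero]

theorem coeffMap_add {k A : Type*} [Field k] [CommRing A] [Algebra k A] (π : A →ₗ[k] A)
    (p q : MvPolynomial (Fin 2) A) : coeffMap π (p + q) = coeffMap π p + coeffMap π q := by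
  ext s; simp [coeff_coeffMap]

theorem coeffMap_mul {k A : Type*} [Field k] [CommRing A] [Algebra k A] (π : A →ₗ[k] A)
    (c : MvPolynomial (Fin 2) k) (p : MvPolynomial (Fin 2) A) :
    coeffMap π (map (algebraMap k A) c * p) = map (algebraMap k A) c * coeffMap π p := by
  classical
  ext s
  simp only [coeff_coeffMap, coeff_mul, map_sum, coeff_map, ← Algebra.smul_def, map_smul]

/-- A compatible sequence of projections onto a decreasing sequence of subspaces. -/
theorem exists_proj {k A : Type*} [Field k] [CommRing A] [Algebra k A] (V : ℕ → Submodule k A)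
    (h0 : V 0 = ⊤) (hV : Antitone V) :
    ∃ ρ : ℕ → A →ₗ[k] A, ρ 0 = LinearMap.id ∧ (∀ d x, ρ d x ∈ V d) ∧
      (∀ d, ∀ x ∈ V d, ρ d x = x) ∧ (∀ d x, ρ (d+1) (ρ d x) = ρ (d+1) x) := by
  have hp : ∀ d, ∃ p : A →ₗ[k] A, (∀ x, p x ∈ V d) ∧ ∀ x ∈ V d, p x = x := by
    intro d
    obtain ⟨g, hg⟩ := (V d).subtype.exists_leftInverse_of_injective (by simp)
    refine ⟨(V d).subtype ∘ₗ g, fun x => by simp, fun x hx => ?_⟩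
    have := LinearMap.congr_fun hg ⟨x, hx⟩
    simpa using congrArg Subtype.val this
  choose p hp1 hp2 using hp
  let ρ : ℕ → A →ₗ[k] A := fun d => Nat.rec LinearMap.id (fun d r => p (d+1) ∘ₗ r) d
  have hs : ∀ d x, ρ (d+1) x = p (d+1) (ρ d x) := fun d x => rfl
  have h1 : ∀ d x, ρ d x ∈ V d := by
    intro d x
    cases d with
    | zero => rw [h0]; trivial
    | succ d => rw [hs]; exact hp1 _ _
  have h2 : ∀ d, ∀ x ∈ V d, ρ d x = x := by
    intro d
    induction d with
    | zero => intro x _; rfl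
    | succ d ih =>
      intro x hx
      rw [hs, ih x (hV (Nat.le_succ d) hx), hp2 _ _ hx]
  refine ⟨ρ, rfl, h1, h2, fun d x => ?_⟩
  rw [hs, hs, h2 d _ (h1 d x)]

theorem sup_pow_le' {B : Type*} [CommRing B] (l : B) (K : Ideal B) (m : ℕ) {f : B}
    (hf : f ∈ (Ideal.span {l} ⊔ K) ^ m) (p : B → Prop) (hadd : ∀ x y, p x → p y → p (x + y))
    (h0 : p 0)
    (h : ∀ a ≤ m, ∀ z ∈ K ^ (m - a), p (l ^ a * z)) : p f := by
  rw [← Ideal.add_eq_sup, add_pow] at hf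
  have hle : ∑ a ∈ Finset.range (m + 1), Ideal.span {l} ^ a * K ^ (m - a) * ((m.choose a : ℕ) : Ideal B)
      ≤ ⨆ a : Fin (m + 1), Ideal.span {l ^ (a : ℕ)} * K ^ (m - a) := by
    rw [Ideal.sum_eq_sup]
    refine Finset.sup_le fun a ha => ?_
    refine Ideal.mul_le_left.trans ?_
    rw [Ideal.span_singleton_pow]
    exact le_iSup (fun a : Fin (m + 1) => Ideal.span {l ^ (a : ℕ)} * K ^ (m - a))
      ⟨a, Finset.mem_range.mp ha⟩
  refine Submodule.iSup_induction _ (motive := p) (hle hf) ?_ h0 hadd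
  intro a x hx
  obtain ⟨z, hz, rfl⟩ := Ideal.mem_span_singleton_mul.mp hx
  exact h a (by omega) z hz

theorem step_abstract {k A : Type*} [Field k] [CommRing A] [Algebra k A]
    {ι : Type*} (X : Finset ι) (l : ι → MvPolynomial (Fin 2) k)
    (hrel : ∀ u ∈ X, ∀ v ∈ X, u ≠ v → ∀ n : ℕ, IsRelPrime ((map (algebraMap k A) (l u)) ^ n)
      ((map (algebraMap k A) (l v)) ^ n))
    (hdec : DecompositionMonoid (MvPolynomial (Fin 2) A))
    (K : Ideal A) (m : ℕ) (f : MvPolynomial (Fin 2) A)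
    (hf : ∀ u ∈ X, f ∈ (Ideal.span {map (algebraMap k A) (l u)} ⊔ K.map C) ^ m) :
    f ∈ (Ideal.span {∏ u ∈ X, map (algebraMap k A) (l u)} ⊔ K.map C) ^ m := by
  obtain ⟨ρ, hρ0, hρ1, hρ2, hρ3⟩ := exists_proj (k := k) (A := A)
    (fun d => (K ^ d).restrictScalars k) (by simp) (fun a b hab x hx => Ideal.pow_le_pow_right hab hx)
  have hρ1' : ∀ d x, ρ d x ∈ K ^ d := hρ1
  have hρ2' : ∀ d, ∀ x ∈ K ^ d, ρ d x = x := hρ2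
  set J := Ideal.span {∏ u ∈ X, map (algebraMap k A) (l u)} ⊔ K.map (C : A →+* MvPolynomial (Fin 2) A)
    with hJ
  have hKmem : ∀ d (g : MvPolynomial (Fin 2) A), g ∈ (K.map C) ^ d ↔ ∀ s, coeff s g ∈ K ^ d := by
    intro d g
    rw [← Ideal.map_pow, mem_map_C_iff]
  -- main claim
  have main : ∀ d < m, coeffMap (ρ d - ρ (d+1)) f ∈ J ^ m := by
    intro d hd
    set π := ρ d - ρ (d+1) with hπ
    have hπ1 : ∀ x, π x ∈ K ^ d := fun x =>
      sub_mem (hρ1' d x) (Ideal.pow_le_pow_right (Nat.le_succ d) (hρ1' (d+1) x))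
    have hπ0 : ∀ x ∈ K ^ (d+1), π x = 0 := by
      intro x hx
      simp [hπ, hρ2' (d+1) x hx, hρ2' d x (Ideal.pow_le_pow_right (Nat.le_succ d) hx)]
    have hπ2 : ∀ x, π (π x) = π x := by
      intro x
      simp only [hπ, LinearMap.sub_apply, map_sub]
      rw [hρ2' d _ (hρ1' d x), hρ3, hρ2' (d+1) _ (hρ1' (d+1) x),
        hρ2' d _ (Ideal.pow_le_pow_right (Nat.le_succ d) (hρ1' (d+1) x))]
      ring
    have hdvd : ∀ u ∈ X, (map (algebraMap k A) (l u)) ^ (m - d) ∣ coeffMap π f := by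
      intro u hu
      refine sup_pow_le' _ _ m (hf u hu)
        (fun g => (map (algebraMap k A) (l u)) ^ (m - d) ∣ coeffMap π g) ?_ ?_ ?_
      · intro x y hx hy
        rw [coeffMap_add]; exact dvd_add hx hy
      · simp [coeffMap]
      · intro a ha z hz
        rw [← map_pow _ _ a, coeffMap_mul, map_pow]
        by_cases h : m - d ≤ a
        · exact (pow_dvd_pow _ h).mul_right _
        · have : coeffMap π z = 0 := by
            ext s
            rw [coeff_coeffMap, coeff_zero]
            exact hπ0 _ (Ideal.pow_le_pow_right (by omega) ((hKmem _ _).mp hz s))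
          rw [this, mul_zero]; exact dvd_zero _
    have hprod : (∏ u ∈ X, map (algebraMap k A) (l u)) ^ (m - d) ∣ coeffMap π f := by
      rw [← Finset.prod_pow]
      refine Finset.prod_dvd_of_isRelPrime ?_ hdvd
      intro u hu v hv huv
      exact hrel u hu v hv huv _
    obtain ⟨h, hh⟩ := hprod
    have hππ : coeffMap π (coeffMap π f) = coeffMap π f := by
      ext s; simp only [coeff_coeffMap, hπ2]
    have : coeffMap π f = (∏ u ∈ X, map (algebraMap k A) (l u)) ^ (m - d) * coeffMap π h := by
      rw [← hππ, hh, ← map_prod, ← map_pow, coeffMap_mul]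
    rw [this, show J ^ m = J ^ (m - d) * J ^ d by rw [← pow_add]; congr 1; omega]
    refine Ideal.mul_mem_mul (Ideal.pow_mem_pow ?_ _) ?_
    · exact Ideal.mem_sup_left (Ideal.mem_span_singleton_self _)
    · refine Ideal.pow_right_mono (le_sup_right : K.map C ≤ J) d ((hKmem _ _).mpr fun s => ?_)
      rw [coeff_coeffMap]; exact hπ1 _
  have hsum : ∀ n ≤ m, f - coeffMap (ρ n) f ∈ J ^ m := by
    intro n
    induction n with
    | zero =>
      intro _
      have : coeffMap (ρ 0) f = f := by ext s; simp [coeff_coeffMap, hρ0]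
      rw [this, sub_self]; exact zero_mem _
    | succ n ih =>
      intro hn
      have h1 := add_mem (ih (by omega)) (main n (by omega))
      have : f - coeffMap (ρ n) f + coeffMap (ρ n - ρ (n+1)) f = f - coeffMap (ρ (n+1)) f := by
        ext s; simp [coeff_coeffMap]
      rwa [this] at h1
  have hlast : coeffMap (ρ m) f ∈ J ^ m := by
    refine Ideal.pow_right_mono (le_sup_right : K.map C ≤ J) m ((hKmem _ _).mpr fun s => ?_)
    rw [coeff_coeffMap]; exact hρ1' _ _
  simpa using add_mem (hsum m le_rfl) hlast

/-- the linear form in two variables -/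
def lin2 {k : Type*} [Field k] (u : k × k) : MvPolynomial (Fin 2) k :=
  C u.2 * X 0 - C u.1 * X 1

theorem lin2_relPrime {k σ : Type*} [Field k] (u v : k × k)
    (huv : ¬ ProjEq u v) (n : ℕ) :
    IsRelPrime ((map (algebraMap k (MvPolynomial σ k)) (lin2 u)) ^ n)
      ((map (algebraMap k (MvPolynomial σ k)) (lin2 v)) ^ n) := by
  refine IsRelPrime.pow ?_
  set φ := map (σ := Fin 2) (algebraMap k (MvPolynomial σ k))
  have hdet : u.1 * v.2 - u.2 * v.1 ≠ 0 := sub_ne_zero.mpr huv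
  have hu : IsUnit (φ (C (u.1 * v.2 - u.2 * v.1))) :=
    ((IsUnit.mk0 _ hdet).map C).map φ
  have e0 : φ (C (u.1 * v.2 - u.2 * v.1)) * X 0 =
      φ (C u.1) * φ (lin2 v) - φ (C v.1) * φ (lin2 u) := by
    have : (X 0 : MvPolynomial (Fin 2) (MvPolynomial σ k)) = φ (X 0) := by simp [φ]
    rw [this, ← map_mul, ← map_mul, ← map_mul, ← map_sub]
    congr 1
    simp only [lin2, map_sub, map_mul]; ring
  have e1 : φ (C (u.1 * v.2 - u.2 * v.1)) * X 1 =
      φ (C u.2) * φ (lin2 v) - φ (C v.2) * φ (lin2 u) := by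
    have : (X 1 : MvPolynomial (Fin 2) (MvPolynomial σ k)) = φ (X 1) := by simp [φ]
    rw [this, ← map_mul, ← map_mul, ← map_mul, ← map_sub]
    congr 1
    simp only [lin2, map_sub, map_mul]; ring
  intro d hdu hdv
  have d0 : d ∣ X 0 := by
    rw [← hu.dvd_mul_left, e0]
    exact dvd_sub (hdv.mul_left _) (hdu.mul_left _)
  have d1 : d ∣ X 1 := by
    rw [← hu.dvd_mul_left, e1]
    exact dvd_sub (hdv.mul_left _) (hdu.mul_left _)
  have hirr : Irreducible (X 0 : MvPolynomial (Fin 2) (MvPolynomial σ k)) := 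
    (MvPolynomial.X_prime).irreducible
  refine (hirr.isRelPrime_iff_not_dvd.mpr ?_) d0 d1
  simp [X_dvd_X]

/-- separate the variables of index `i` -/
def splitEquiv {t : ℕ} (i : Fin t) : Fin t × Fin 2 ≃ Fin 2 ⊕ ({j : Fin t // j ≠ i} × Fin 2) where
  toFun p := if h : p.1 = i then Sum.inl p.2 else Sum.inr (⟨p.1, h⟩, p.2)
  invFun := Sum.elim (fun c => (i, c)) (fun q => (q.1.1, q.2))
  left_inv := by
    rintro ⟨j, c⟩
    by_cases h : j = i
    · subst h; simp
    · simp [h]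
  right_inv := by
    rintro (c | ⟨⟨j, h⟩, c⟩)
    · simp
    · simp [h]

def splitAlg (k : Type*) [Field k] {t : ℕ} (i : Fin t) : MvPolynomial (Fin t × Fin 2) k ≃ₐ[k]
    MvPolynomial (Fin 2) (MvPolynomial ({j : Fin t // j ≠ i} × Fin 2) k) :=
  (renameEquiv k (splitEquiv i)).trans (sumAlgEquiv k _ _)

def lin {k : Type*} [Field k] {t : ℕ} (i : Fin t) (u : k × k) : MvPolynomial (Fin t × Fin 2) k :=
  C u.2 * X (i, 0) - C u.1 * X (i, 1)

theorem splitAlg_X_self {k : Type*} [Field k] {t : ℕ} (i : Fin t) (c : Fin 2) :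
    splitAlg k i (X (i, c)) = X c := by
  simp [splitAlg, splitEquiv]

theorem splitAlg_X_ne {k : Type*} [Field k] {t : ℕ} (i j : Fin t) (h : j ≠ i) (c : Fin 2) :
    splitAlg k i (X (j, c)) = C (X (⟨j, h⟩, c)) := by
  simp [splitAlg, splitEquiv, h]

theorem splitAlg_C {k : Type*} [Field k] {t : ℕ} (i : Fin t) (a : k) :
    splitAlg k i (C a) = C (C a) := by
  have := (splitAlg k i).commutes a
  simpa [MvPolynomial.algebraMap_eq] using this

theorem splitAlg_lin_self {k : Type*} [Field k] {t : ℕ} (i : Fin t) (u : k × k) :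
    splitAlg k i (lin i u) = map (algebraMap k _) (lin2 u) := by
  simp [lin, lin2, splitAlg_X_self, splitAlg_C, MvPolynomial.algebraMap_eq]

theorem splitAlg_lin_ne {k : Type*} [Field k] {t : ℕ} (i j : Fin t) (h : j ≠ i) (u : k × k) :
    ∃ g, splitAlg k i (lin j u) = C g := by
  refine ⟨C u.2 * X (⟨j, h⟩, 0) - C u.1 * X (⟨j, h⟩, 1), ?_⟩
  simp [lin, splitAlg_X_ne i j h, splitAlg_C]

theorem mem_map_equiv' {k R S : Type*} [Field k] [CommRing R] [CommRing S] [Algebra k R]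
    [Algebra k S] (e : R ≃ₐ[k] S) (f : R) (I : Ideal R) :
    f ∈ I ↔ e f ∈ I.map (e : R →+* S) := by
  constructor
  · exact fun h => Ideal.mem_map_of_mem (e : R →+* S) h
  · intro h
    obtain ⟨x, hx, hxf⟩ := (Ideal.mem_map_iff_of_surjective (e : R →+* S) e.surjective).mp h
    have : x = f := e.injective hxf
    rwa [← this]

theorem map_key {k R S A ι : Type*} [Field k] [CommRing R] [CommRing S] [Algebra k R]
    [Algebra k S] [CommRing A] (e : R ≃ₐ[k] S) (c : A →+* S) (G : ι → R) (g : ι → A)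
    (hg : ∀ j, e (G j) = c (g j)) (m : ℕ) (q : R) :
    ((Ideal.span {q} ⊔ Ideal.span (Set.range G)) ^ m).map (e : R →+* S) =
      (Ideal.span {e q} ⊔ (Ideal.span (Set.range g)).map c) ^ m := by
  have h : (e : R →+* S) ∘ G = c ∘ g := funext hg
  rw [Ideal.map_pow, Ideal.map_sup, Ideal.map_span, Ideal.map_span, Ideal.map_span,
    Set.image_singleton, ← Set.range_comp, ← Set.range_comp, h]
  rfl

theorem ufd_decomp (k σ : Type*) [Field k] :
    DecompositionMonoid (MvPolynomial (Fin 2) (MvPolynomial σ k)) := by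
  have h1 : UniqueFactorizationMonoid (MvPolynomial σ k) := inferInstance
  have h2 : UniqueFactorizationMonoid (MvPolynomial (Fin 2) (MvPolynomial σ k)) :=
    MvPolynomial.uniqueFactorizationMonoid (D := MvPolynomial σ k) (Fin 2)
  exact UniqueFactorizationMonoid.instDecompositionMonoid

theorem step_concrete {k : Type*} [Field k] {t : ℕ} (i : Fin t) (Y : Finset (k × k))
    (hdist : ∀ u ∈ Y, ∀ v ∈ Y, u ≠ v → ¬ ProjEq u v)
    (G : {j : Fin t // j ≠ i} → MvPolynomial (Fin t × Fin 2) k)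
    (hG : ∀ j, ∃ g, splitAlg k i (G j) = C g) (m : ℕ) (f : MvPolynomial (Fin t × Fin 2) k)
    (hf : ∀ u ∈ Y, f ∈ (Ideal.span {lin i u} ⊔ Ideal.span (Set.range G)) ^ m) :
    f ∈ (Ideal.span {∏ u ∈ Y, lin i u} ⊔ Ideal.span (Set.range G)) ^ m := by
  choose g hg using hG
  have key := map_key (splitAlg k i) C G g hg m
  have hmem := mem_map_equiv' (splitAlg k i) f
  rw [hmem, key, map_prod]
  simp only [splitAlg_lin_self]
  have hdec : DecompositionMonoid (MvPolynomial (Fin 2)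
      (MvPolynomial ({j : Fin t // j ≠ i} × Fin 2) k)) := ufd_decomp _ _
  refine step_abstract Y lin2 (fun u hu v hv huv n => lin2_relPrime u v (hdist u hu v hv huv) n)
    hdec _ m _ fun u hu => ?_
  rw [← splitAlg_lin_self, ← key, ← hmem]
  exact hf u hu

theorem span_split {B : Type*} [CommRing B] {t : ℕ} (i : Fin t) (G : Fin t → B) :
    Ideal.span (Set.range G) =
      Ideal.span {G i} ⊔ Ideal.span (Set.range fun j : {j : Fin t // j ≠ i} => G j) := by
  rw [← Ideal.span_union]
  congr 1
  ext x
  constructor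
  · rintro ⟨j, rfl⟩
    by_cases h : j = i
    · subst h; simp
    · exact Or.inr ⟨⟨j, h⟩, rfl⟩
  · rintro (h | ⟨j, rfl⟩)
    · exact ⟨i, h.symm⟩
    · exact ⟨j, rfl⟩

def gen {k : Type*} [Field k] {t : ℕ} (Xs : Fin t → Finset (k × k)) (S : Finset (Fin t))
    (P : Fin t → k × k) (j : Fin t) : MvPolynomial (Fin t × Fin 2) k :=
  if j ∈ S then ∏ u ∈ Xs j, lin j u else lin j (P j)

theorem gen_C {k : Type*} [Field k] {t : ℕ} (Xs : Fin t → Finset (k × k)) (S : Finset (Fin t))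
    (P : Fin t → k × k) (i j : Fin t) (h : j ≠ i) : ∃ g, splitAlg k i (gen Xs S P j) = C g := by
  unfold gen
  split_ifs
  · choose g hg using splitAlg_lin_ne (k := k) i j h
    exact ⟨∏ u ∈ Xs j, g u, by rw [map_prod, map_prod]; simp [hg]⟩
  · exact splitAlg_lin_ne i j h _

/-- If `Z = X_1 × ⋯ × X_t ⊆ (P^1)^t` is a finite product of finite
nonempty subsets of `P^1`, then `I(Z)^m = I(Z)^(m)` for all `m ≥ 1`, where
`I(Z)^(m) = ∩_{P ∈ Z} I(P)^m`. -/
theorem product_points_symbolic_eq_ordinary {k : Type*} [Field k] [IsAlgClosed k]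
    (t : ℕ) (ht : 1 ≤ t) (Xs : Fin t → Finset (k × k))
    (hne : ∀ i, (Xs i).Nonempty)
    (hnz : ∀ i, ∀ u ∈ Xs i, u ≠ (0 : k × k))
    (hdist : ∀ i, ∀ u ∈ Xs i, ∀ v ∈ Xs i, u ≠ v → ¬ ProjEq u v)
    (m : ℕ) (hm : 1 ≤ m) :
    (⨅ (P : Fin t → k × k) (_ : ∀ i, P i ∈ Xs i), pointIdealMulti P) ^ m
      = ⨅ (P : Fin t → k × k) (_ : ∀ i, P i ∈ Xs i), (pointIdealMulti P) ^ m := by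
  apply le_antisymm
  · exact le_iInf₂ fun P hP => Ideal.pow_right_mono (iInf₂_le P hP) m
  intro f hf
  have hf' : ∀ P : Fin t → k × k, (∀ i, P i ∈ Xs i) → f ∈ pointIdealMulti P ^ m := by
    intro P hP
    simp only [Ideal.mem_iInf] at hf
    exact hf P hP
  have main : ∀ S : Finset (Fin t), ∀ P : Fin t → k × k, (∀ i, P i ∈ Xs i) →
      f ∈ Ideal.span (Set.range (gen Xs S P)) ^ m := by
    intro S
    induction S using Finset.induction_on with
    | empty =>
      intro P hP
      have : gen Xs ∅ P = fun i : Fin t => C (P i).2 * X (i, 0) - C (P i).1 * X (i, 1) := by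
        funext i; simp [gen, lin]
      rw [this]
      exact hf' P hP
    | insert i S hi ih =>
      intro P hP
      have e1 : gen Xs (insert i S) P i = ∏ u ∈ Xs i, lin i u := by simp [gen]
      rw [span_split i, e1]
      refine step_concrete i (Xs i) (hdist i) _ (fun j => gen_C Xs _ P i j j.2) m f ?_
      intro u hu
      have h2 := ih (Function.update P i u) (by
        intro j
        by_cases h : j = i
        · subst h; simpa using hu
        · simpa [h] using hP j)
      have e2 : gen Xs S (Function.update P i u) i = lin i u := by simp [gen, hi]
      rw [span_split i, e2] at h2
      have e3 : (fun j : {j : Fin t // j ≠ i} => gen Xs S (Function.update P i u) j) =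
          fun j : {j : Fin t // j ≠ i} => gen Xs (insert i S) P j := by
        funext j
        simp [gen, j.2]
      rwa [e3] at h2
  choose P0 hP0 using hne
  refine Ideal.pow_right_mono ?_ m (main Finset.univ P0 hP0)
  refine le_iInf₂ fun P hP => ?_
  rw [Ideal.span_le]
  rintro _ ⟨j, rfl⟩
  have : lin j (P j) ∈ pointIdealMulti P := Ideal.subset_span ⟨j, rfl⟩
  simp only [gen, Finset.mem_univ, if_true]
  exact Ideal.mem_of_dvd _ (Finset.dvd_prod_of_mem _ (hP j)) this
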